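/- arXiv:0707.0659 — 8 statements merged into one kernel-verified Lean document; each statement's English description precedes it below -/
import Mathlib

section
/- For every α ∈ ℂ, the operators h, e, f on ℂ[x] satisfy the sl₂(ℂ)-relations: h∘e − e∘h = 2e, h∘f − f∘h = −2f, and e∘f − f∘e = h. -/
open Polynomial

/-- The operator `E_m` on `ℂ[x]` given by `(E_m p)(x) = (α·m − x)·p(x+m)`. -/
noncomputable def E (α : ℂ) (m : ℤ) : Module.End ℂ (Polynomial ℂ) :=
  LinearMap.mulLeft ℂ (C (α * m) - X) ∘ₗ (aeval (X + C (m : ℂ))).toLinearMap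

/-- `h = E₁ − E₋₁`. -/
noncomputable def hOp (α : ℂ) : Module.End ℂ (Polynomial ℂ) := E α 1 - E α (-1)

/-- `e = ½(E₁ − 2E₀ + E₋₁)`. -/
noncomputable def eOp (α : ℂ) : Module.End ℂ (Polynomial ℂ) :=
  (1/2 : ℂ) • (E α 1 - (2 : ℂ) • E α 0 + E α (-1))

/-- `f = −½(E₁ + 2E₀ + E₋₁)`. -/
noncomputable def fOp (α : ℂ) : Module.End ℂ (Polynomial ℂ) :=
  -((1/2 : ℂ) • (E α 1 + (2 : ℂ) • E α 0 + E α (-1)))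

theorem E_apply (α : ℂ) (m : ℤ) (p : Polynomial ℂ) :
    E α m p = (C (α * m) - X) * p.comp (X + C (m : ℂ)) := by
  simp [E, comp, aeval_def, eval₂_eq_eval_map]

/-- The commutation relation `[E_m, E_n] = (n - m) E_{m+n}`. -/
theorem E_mul_sub_E_mul (α : ℂ) (m n : ℤ) :
    E α m * E α n - E α n * E α m = ((n : ℂ) - m) • E α (m + n) := by
  refine LinearMap.ext fun p => ?_
  have hmn : (X + C (n : ℂ)).comp (X + C (m : ℂ)) = X + C ((m + n : ℤ) : ℂ) := by
    simp only [add_comp, X_comp, C_comp, Int.cast_add, C_add]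
    ring
  have hnm : (X + C (m : ℂ)).comp (X + C (n : ℂ)) = X + C ((m + n : ℤ) : ℂ) := by
    simp only [add_comp, X_comp, C_comp, Int.cast_add, C_add]
    ring
  simp only [LinearMap.sub_apply, Module.End.mul_apply, LinearMap.smul_apply, E_apply, mul_comp,
    sub_comp, C_comp, X_comp, comp_assoc, hmn, hnm, smul_eq_C_mul]
  simp only [Int.cast_add, C_add, C_sub, C_mul, mul_add]
  ring

/-- The operators `h, e, f` on `ℂ[x]` satisfy the `sl₂(ℂ)`-relations. -/
theorem sl2_relations (α : ℂ) :
    hOp α ∘ₗ eOp α - eOp α ∘ₗ hOp α = (2 : ℂ) • eOp α ∧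
    hOp α ∘ₗ fOp α - fOp α ∘ₗ hOp α = (-2 : ℂ) • fOp α ∧
    eOp α ∘ₗ fOp α - fOp α ∘ₗ eOp α = hOp α := by
  have h₁ := E_mul_sub_E_mul α 1 0
  have h₂ := E_mul_sub_E_mul α (-1) 0
  have h₃ := E_mul_sub_E_mul α 1 (-1)
  norm_num at h₁ h₂ h₃
  have hf : fOp α = (-1 / 2 : ℂ) • (E α 1 + (2 : ℂ) • E α 0 + E α (-1)) := by
    rw [fOp]
    module
  simp only [← Module.End.mul_eq_comp, hOp, eOp, hf, mul_add, add_mul, mul_sub, sub_mul,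
    smul_mul_assoc, mul_smul_comm]
  rw [sub_eq_iff_eq_add] at h₁ h₂ h₃
  rw [h₁, h₂, h₃]
  refine ⟨?_, ?_, ?_⟩ <;> module
end

section
/- Let α ∈ ℂ with α ≠ 0. Then the module ℂ_α[x] is irreducible over the Lie algebra of vector fields on a circle: every ℂ-linear subspace of ℂ[x] that is invariant under all the operators E_m, m ∈ ℤ, is either {0} or all of ℂ[x]. -/
open Polynomial

/-- If a polynomial `r(y)` with coefficients in `ℂ[x]` takes values in a subspace `U` at every
integer, then all its coefficients lie in `U`. -/
theorem coeff_mem_of_eval_intCast_mem (U : Submodule ℂ (Polynomial ℂ))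
    (r : Polynomial (Polynomial ℂ)) (hr : ∀ m : ℤ, r.eval (C (m : ℂ)) ∈ U) (k : ℕ) :
    r.coeff k ∈ U := by
  by_contra hk
  obtain ⟨φ, hφk, hφU⟩ := Submodule.exists_le_ker_of_notMem hk
  let s : Polynomial ℂ := ∑ i ∈ r.support, monomial i (φ (r.coeff i))
  have hs : s = 0 := by
    refine eq_zero_of_infinite_isRoot s
      ((Set.infinite_range_of_injective (Int.cast_injective (α := ℂ))).mono ?_)
    rintro _ ⟨m, rfl⟩
    have h : φ (r.eval (C (m : ℂ))) = 0 := hφU (hr m)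
    rw [eval_eq_sum, sum_def, map_sum] at h
    change s.eval (m : ℂ) = 0
    rw [← h, eval_finsetSum]
    refine Finset.sum_congr rfl fun i _ => ?_
    rw [eval_monomial, ← C_pow, mul_comm (r.coeff i), ← smul_eq_C_mul, map_smul, smul_eq_mul,
      mul_comm]
  apply hφk
  have h : s.coeff k = φ (r.coeff k) := by
    simp only [s, finsetSum_coeff, coeff_monomial, Finset.sum_ite_eq', mem_support_iff]
    split_ifs with h
    · rfl
    · rw [not_not.mp h, map_zero]
  rw [← h, hs, coeff_zero]

/-- The polynomial in `y` over `ℂ[x]` interpolating `m ↦ E α m p`. -/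
noncomputable def interpolatedE (α : ℂ) (p : Polynomial ℂ) : Polynomial (Polynomial ℂ) :=
  (C (C α) * X + C (-X)) * taylor X (p.map C)

theorem eval_interpolatedE (α : ℂ) (p : Polynomial ℂ) (m : ℤ) :
    (interpolatedE α p).eval (C (m : ℂ)) = E α m p := by
  simp only [interpolatedE, eval_mul, eval_add, eval_C, eval_X, taylor_eval, eval_map]
  simp [E, aeval_def, add_comm, sub_eq_add_neg]

theorem leadingCoeff_interpolatedE {α : ℂ} (hα : α ≠ 0) (p : Polynomial ℂ) :
    (interpolatedE α p).leadingCoeff = C (α * p.leadingCoeff) := by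
  rw [interpolatedE, leadingCoeff_mul, leadingCoeff_linear (C_ne_zero.mpr hα),
    leadingCoeff_taylor, leadingCoeff_map_of_injective C_injective, C_mul]

/-- For `α ≠ 0`, the module `ℂ_α[x]` is irreducible over the Lie algebra of
vector fields on a circle: every subspace invariant under all the `E_m` is
`{0}` or all of `ℂ[x]`. -/
theorem C_alpha_irreducible (α : ℂ) (hα : α ≠ 0)
    (U : Submodule ℂ (Polynomial ℂ))
    (hU : ∀ (m : ℤ), ∀ p ∈ U, E α m p ∈ U) :
    U = ⊥ ∨ U = ⊤ := by
  refine or_iff_not_imp_left.mpr fun hne => ?_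
  obtain ⟨p, hp, hp0⟩ := U.exists_mem_ne_zero_of_ne_bot hne
  have hconst : C (α * p.leadingCoeff) ∈ U := by
    rw [← leadingCoeff_interpolatedE hα]
    exact coeff_mem_of_eval_intCast_mem U _
      (fun m => eval_interpolatedE α p m ▸ hU m p hp) _
  have hX : ∀ q ∈ U, X * q ∈ U := fun q hq => by
    simpa [E] using hU 0 q hq
  have hc : α * p.leadingCoeff ≠ 0 := mul_ne_zero hα (leadingCoeff_ne_zero.mpr hp0)
  have hone : (1 : Polynomial ℂ) ∈ U := by
    have h := U.smul_mem (α * p.leadingCoeff)⁻¹ hconst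
    rwa [smul_C, smul_eq_mul, inv_mul_cancel₀ hc, C_1] at h
  have hpow : ∀ n : ℕ, (X ^ n : Polynomial ℂ) ∈ U := fun n => by
    induction n with
    | zero => simpa using hone
    | succ n ih => simpa [pow_succ'] using hX _ ih
  refine eq_top_iff.mpr fun q _ => ?_
  rw [q.as_sum_support_C_mul_X_pow]
  exact U.sum_mem fun i _ => smul_eq_C_mul (q.coeff i) ▸ U.smul_mem _ (hpow i)
end

section
/- For all α₁, α₂ ∈ ℂ and every n ∈ ℕ, the Casimir operator Ω preserves the space of polynomials of total degree at most n: if p ∈ ℂ[x,y] has total degree ≤ n, then Ω p has total degree ≤ n (even though each of the three individual terms of Ω increases the degree). -/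
open MvPolynomial

/-- The substitution `p(x,y) ↦ p(x+a, y+b)` on `ℂ[x,y]`. -/
noncomputable def shift (a b : ℂ) : MvPolynomial (Fin 2) ℂ →ₐ[ℂ] MvPolynomial (Fin 2) ℂ :=
  aeval ![X 0 + C a, X 1 + C b]

/-- The Casimir operator `Ω` on `ℂ[x,y]`:
`(Ω p)(x,y) = −½(x−α₁)(y+α₂)·p(x+1,y−1) + xy·p(x,y) − ½(x+α₁)(y−α₂)·p(x−1,y+1)`. -/
noncomputable def Omega (α₁ α₂ : ℂ) : Module.End ℂ (MvPolynomial (Fin 2) ℂ) :=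
  (-(1/2 : ℂ)) • (LinearMap.mulLeft ℂ ((X 0 - C α₁) * (X 1 + C α₂)) ∘ₗ
      (shift 1 (-1)).toLinearMap)
  + LinearMap.mulLeft ℂ ((X 0 : MvPolynomial (Fin 2) ℂ) * X 1)
  + (-(1/2 : ℂ)) • (LinearMap.mulLeft ℂ ((X 0 + C α₁) * (X 1 - C α₂)) ∘ₗ
      (shift (-1) 1).toLinearMap)

/-- The polynomials all of whose monomials have degree less than `n`; for `n = 0` this is zero. -/
noncomputable def totalDegreeLT (n : ℕ) : Submodule ℂ (MvPolynomial (Fin 2) ℂ) :=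
  restrictSupport ℂ {s | s.degree < n}

theorem mem_totalDegreeLT_succ {n : ℕ} {p : MvPolynomial (Fin 2) ℂ} :
    p ∈ totalDegreeLT (n + 1) ↔ p.totalDegree ≤ n := by
  simp only [totalDegreeLT, mem_restrictSupport_iff, Set.subset_def, Finset.mem_coe,
    Set.mem_ofPred_eq, Nat.lt_succ_iff]
  exact Finset.sup_le_iff.symm

theorem eq_zero_of_mem_totalDegreeLT_zero {p : MvPolynomial (Fin 2) ℂ}
    (hp : p ∈ totalDegreeLT 0) : p = 0 := by
  ext s
  have : ∀ s, coeff s p = 0 := by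
    simpa [totalDegreeLT, mem_restrictSupport_iff, Set.subset_def] using hp
  simpa using this s

theorem totalDegreeLT_mono {m n : ℕ} (h : m ≤ n) : totalDegreeLT m ≤ totalDegreeLT n :=
  restrictSupport_mono _ fun _ hs => lt_of_lt_of_le hs h

theorem X_mul_mem_totalDegreeLT {n : ℕ} {p : MvPolynomial (Fin 2) ℂ} (i : Fin 2)
    (hp : p ∈ totalDegreeLT n) : X i * p ∈ totalDegreeLT (n + 1) := by
  intro s hs
  rw [Finset.mem_coe] at hs
  change s ∈ (X i * p).support at hs
  rw [support_X_mul, Finset.mem_map] at hs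
  obtain ⟨t, ht, rfl⟩ := hs
  have : t.degree < n := hp ht
  simp only [addLeftEmbedding_apply, Set.mem_ofPred_eq, map_add, Finsupp.degree_single]
  omega

theorem C_mul_mem_totalDegreeLT {n : ℕ} {p : MvPolynomial (Fin 2) ℂ} (c : ℂ)
    (hp : p ∈ totalDegreeLT n) : C c * p ∈ totalDegreeLT n := by
  rw [← smul_eq_C_mul]
  exact Submodule.smul_mem _ c hp

/-- The difference operator `p(x,y) ↦ p(x+a, y+b) - p(x,y)`. -/
noncomputable def shiftDiff (a b : ℂ) : Module.End ℂ (MvPolynomial (Fin 2) ℂ) :=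
  (shift a b).toLinearMap - LinearMap.id

theorem shiftDiff_apply (a b : ℂ) (p : MvPolynomial (Fin 2) ℂ) :
    shiftDiff a b p = shift a b p - p := rfl

theorem shift_X (a b : ℂ) (i : Fin 2) : shift a b (X i) = X i + C (![a, b] i) := by
  fin_cases i <;> simp [shift]

theorem shift_shift_neg (a b : ℂ) (p : MvPolynomial (Fin 2) ℂ) :
    shift a b (shift (-a) (-b) p) = p := by
  suffices (shift a b).comp (shift (-a) (-b)) = AlgHom.id ℂ _ from DFunLike.congr_fun this p
  ext i : 1
  fin_cases i <;> simp [shift]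

theorem shiftDiff_X_mul (a b : ℂ) (i : Fin 2) (p : MvPolynomial (Fin 2) ℂ) :
    shiftDiff a b (X i * p) =
      X i * shiftDiff a b p + C (![a, b] i) * (shiftDiff a b p + p) := by
  simp only [shiftDiff_apply, map_mul, shift_X]
  ring

theorem shiftDiff_monomial_mem (a b : ℂ) (n : ℕ) (s : Fin 2 →₀ ℕ) (hs : s.degree = n) :
    shiftDiff a b (monomial s 1) ∈ totalDegreeLT n := by
  induction n generalizing s with
  | zero =>
    obtain rfl : s = 0 := (Finsupp.degree_eq_zero_iff s).1 hs
    simp [shiftDiff_apply]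
  | succ n ih =>
    obtain ⟨i, hi⟩ : ∃ i, s i ≠ 0 := by
      by_contra! h
      obtain rfl : s = 0 := Finsupp.ext h
      simp at hs
    obtain ⟨t, rfl⟩ : ∃ t, s = Finsupp.single i 1 + t :=
      exists_add_of_le (Finsupp.single_le_iff.2 (Nat.one_le_iff_ne_zero.2 hi))
    have ht : t.degree = n := by
      simp only [map_add, Finsupp.degree_single] at hs
      omega
    have h1 := ih t ht
    have h2 : monomial t (1 : ℂ) ∈ totalDegreeLT (n + 1) :=
      (monomial_mem_restrictSupport ℂ).2 (Or.inl (by simp [ht]))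
    rw [monomial_single_add, pow_one, shiftDiff_X_mul]
    exact add_mem (X_mul_mem_totalDegreeLT i h1) (C_mul_mem_totalDegreeLT _
      (add_mem (totalDegreeLT_mono n.le_succ h1) h2))

/-- Difference operators lower the degree. -/
theorem shiftDiff_mem_totalDegreeLT (a b : ℂ) {n : ℕ} {p : MvPolynomial (Fin 2) ℂ}
    (hp : p ∈ totalDegreeLT (n + 1)) : shiftDiff a b p ∈ totalDegreeLT n := by
  suffices totalDegreeLT (n + 1) ≤ (totalDegreeLT n).comap (shiftDiff a b) from this hp
  rw [totalDegreeLT, restrictSupport_eq_span, Submodule.span_le]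
  rintro _ ⟨s, hs, rfl⟩
  exact totalDegreeLT_mono (Nat.lt_succ_iff.1 hs) (shiftDiff_monomial_mem a b _ s rfl)

/-- `Ω` in terms of difference operators: the leading parts of its three terms cancel. -/
theorem Omega_eq_shiftDiff (α₁ α₂ : ℂ) (p : MvPolynomial (Fin 2) ℂ) :
    Omega α₁ α₂ p =
      C (1 / 2) * (X 0 * (X 1 * shiftDiff 1 (-1) (shiftDiff (-1) 1 p)))
      - C (1 / 2 * (α₁ * α₂)) * shiftDiff 1 (-1) (shiftDiff (-1) 1 p)
      + C (α₁ * α₂) * p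
      - C (1 / 2 * α₂) * (X 0 * (shiftDiff 1 (-1) p - shiftDiff (-1) 1 p))
      + C (1 / 2 * α₁) * (X 1 * (shiftDiff 1 (-1) p - shiftDiff (-1) 1 p)) := by
  have hinv : shift 1 (-1) (shift (-1) 1 p) = p := by
    simpa using shift_shift_neg 1 (-1) p
  have hhalf : (C (1 / 2) : MvPolynomial (Fin 2) ℂ) * 2 = 1 := by
    rw [← map_ofNat C 2, ← C_mul]
    norm_num
  simp only [Omega, shiftDiff_apply, map_sub, hinv, LinearMap.add_apply, LinearMap.smul_apply,
    LinearMap.comp_apply, LinearMap.mulLeft_apply, AlgHom.toLinearMap_apply, smul_eq_C_mul,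
    C_mul, C_neg]
  linear_combination (C α₁ * C α₂ * p - X 0 * X 1 * p) * hhalf

/-- The Casimir operator `Ω` preserves the space of polynomials of total
degree at most `n`. -/
theorem Omega_preserves_totalDegree (α₁ α₂ : ℂ) (n : ℕ)
    (p : MvPolynomial (Fin 2) ℂ) (hp : p.totalDegree ≤ n) :
    (Omega α₁ α₂ p).totalDegree ≤ n := by
  have hp' := mem_totalDegreeLT_succ.2 hp
  have hd := sub_mem (shiftDiff_mem_totalDegreeLT 1 (-1) hp')
    (shiftDiff_mem_totalDegreeLT (-1) 1 hp')
  have hxy : X 0 * (X 1 * shiftDiff 1 (-1) (shiftDiff (-1) 1 p)) ∈ totalDegreeLT (n + 1) ∧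
      shiftDiff 1 (-1) (shiftDiff (-1) 1 p) ∈ totalDegreeLT (n + 1) := by
    have h1 := shiftDiff_mem_totalDegreeLT (-1) 1 hp'
    cases n with
    | zero => simp [eq_zero_of_mem_totalDegreeLT_zero h1]
    | succ n =>
      have h2 := shiftDiff_mem_totalDegreeLT 1 (-1) h1
      exact ⟨X_mul_mem_totalDegreeLT 0 (X_mul_mem_totalDegreeLT 1 h2),
        totalDegreeLT_mono (by omega) h2⟩
  rw [← mem_totalDegreeLT_succ, Omega_eq_shiftDiff]
  exact add_mem (sub_mem (add_mem (sub_mem (C_mul_mem_totalDegreeLT _ hxy.1)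
    (C_mul_mem_totalDegreeLT _ hxy.2)) (C_mul_mem_totalDegreeLT _ hp'))
    (C_mul_mem_totalDegreeLT _ (X_mul_mem_totalDegreeLT 0 hd)))
    (C_mul_mem_totalDegreeLT _ (X_mul_mem_totalDegreeLT 1 hd))
end

section
/- For all α₁, α₂ ∈ ℂ, the space ℂ[x,y] decomposes into a direct sum of finite-dimensional Ω-invariant subspaces: there exists a family (W_n)_{n∈ℕ} of finite-dimensional ℂ-subspaces of ℂ[x,y], each invariant under Ω, whose internal direct sum is all of ℂ[x,y]. (Proposition 4.3(a).) -/
open MvPolynomial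

universe u

section LinearAlgebra

variable {K V : Type u} [Field K] [AddCommGroup V] [Module K V]

/-- Grouping the vectors of a basis according to the values of a function on the index set
gives an internal direct sum decomposition. -/
theorem Module.Basis.isInternal_span_image_preimage {ι κ : Type*} [DecidableEq κ]
    (b : Module.Basis ι K V) (g : ι → κ) :
    DirectSum.IsInternal fun k => Submodule.span K (b '' (g ⁻¹' {k})) := by
  rw [DirectSum.isInternal_submodule_iff_iSupIndep_and_iSup_eq_top]
  constructor
  · intro k
    simp_rw [← Submodule.span_iUnion, ← Set.image_iUnion]
    refine b.linearIndependent.disjoint_span_image (Set.disjoint_left.2 fun i hi hi' => ?_)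
    simp only [Set.mem_iUnion] at hi'
    obtain ⟨j, hj, hij⟩ := hi'
    exact hj (hij.symm.trans hi)
  · rw [← Submodule.span_iUnion, ← Set.image_iUnion, ← b.span_eq, ← Set.image_univ]
    congr 2
    ext i
    simp

/-- The space has a basis which splits into finite blocks whose spans are invariant under `T`. -/
def HasFiniteBlocks (T : Module.End K V) : Prop :=
  ∃ (ι κ : Type u) (b : Module.Basis ι K V) (g : ι → κ),
    (∀ k, (g ⁻¹' {k}).Finite) ∧ ∀ i, T (b i) ∈ Submodule.span K (b '' (g ⁻¹' {g i}))

theorem HasFiniteBlocks.add_smul_one {N : Module.End K V} (h : HasFiniteBlocks N) (μ : K) :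
    HasFiniteBlocks (N + μ • 1) := by
  obtain ⟨ι, κ, b, g, hfin, hN⟩ := h
  exact ⟨ι, κ, b, g, hfin, fun i => add_mem (hN i) <|
    Submodule.smul_mem _ _ <| Submodule.subset_span ⟨i, rfl, rfl⟩⟩

theorem hasFiniteBlocks_of_mul_self_eq_zero (N : Module.End K V) (hN : N * N = 0) :
    HasFiniteBlocks N := by
  have hN' (v : V) : N (N v) = 0 := LinearMap.congr_fun hN v
  obtain ⟨C, hC⟩ := (LinearMap.ker N).exists_isCompl
  obtain ⟨D, hD⟩ := (LinearMap.range N).exists_isCompl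
  have hCinj (c : C) (hc : N c = 0) : c = 0 := by
    have := Submodule.disjoint_def.1 hC.disjoint (c : V) hc c.2
    simpa using this
  let E : Submodule K V := D ⊓ LinearMap.ker N
  let L : ((C × C) × E) →ₗ[K] V :=
    (C.subtype.coprod (N ∘ₗ C.subtype)).coprod E.subtype
  have hL (c c' : C) (d : E) : L ((c, c'), d) = c + N c' + d := by simp [L]
  have hbij : Function.Bijective L := by
    constructor
    · rw [← LinearMap.ker_eq_bot, LinearMap.ker_eq_bot']
      rintro ⟨⟨c, c'⟩, d⟩ h
      rw [hL] at h
      have hd : N d = 0 := d.2.2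
      obtain rfl : c = 0 := hCinj c (by simpa [hN', hd] using congrArg N h)
      have hd' : (d : V) = N (-c') := by
        rw [map_neg]
        exact eq_neg_of_add_eq_zero_right (by simpa using h)
      have hd0 : (d : V) = 0 :=
        Submodule.disjoint_def.1 hD.disjoint (d : V) ⟨_, hd'.symm⟩ d.2.1
      obtain rfl : d = 0 := by simpa using hd0
      obtain rfl : c' = 0 := hCinj c' (by simpa using h)
      rfl
    · intro v
      obtain ⟨k, hk, c, hc, rfl⟩ :=
        Submodule.mem_sup.1 (hC.sup_eq_top.ge (Submodule.mem_top (x := v)))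
      obtain ⟨_, ⟨w, rfl⟩, d, hd, rfl⟩ :=
        Submodule.mem_sup.1 (hD.sup_eq_top.ge (Submodule.mem_top (x := k)))
      obtain ⟨k', hk', c', hc', rfl⟩ :=
        Submodule.mem_sup.1 (hC.sup_eq_top.ge (Submodule.mem_top (x := w)))
      refine ⟨((⟨c, hc⟩, ⟨c', hc'⟩), ⟨d, hd, ?_⟩), ?_⟩
      · simpa [hN'] using hk
      · have hN' : N (k' + c') = N c' := by simpa using hk'
        rw [hL]
        simp only [hN']
        abel
  let bC := Module.Basis.ofVectorSpace K C
  let bE := Module.Basis.ofVectorSpace K E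
  let b := ((bC.prod bC).prod bE).map (LinearEquiv.ofBijective L hbij)
  let g := Sum.map (Sum.elim id id : _ ⊕ _ → Module.Basis.ofVectorSpaceIndex K C)
    (id : Module.Basis.ofVectorSpaceIndex K E → _)
  refine ⟨_, _, b, g, ?_, ?_⟩
  · rintro (k | k)
    · refine (Set.toFinite {Sum.inl (Sum.inl k), Sum.inl (Sum.inr k)}).subset ?_
      rintro ((i | i) | i) hi <;> simp_all [g]
    · refine (Set.toFinite {Sum.inr k}).subset ?_
      rintro ((i | i) | i) hi <;> simp_all [g]
  · have hb₁ (i) : b (Sum.inl (Sum.inl i)) = bC i := by simp [b, L]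
    have hb₂ (i) : b (Sum.inl (Sum.inr i)) = N (bC i) := by simp [b, L]
    have hb₃ (i) : b (Sum.inr i) = bE i := by simp [b, L]
    rintro ((i | i) | i)
    · rw [hb₁, ← hb₂]
      exact Submodule.subset_span ⟨Sum.inl (Sum.inr i), rfl, rfl⟩
    · rw [hb₂, hN']
      exact zero_mem _
    · rw [hb₃, show N (bE i) = 0 from (bE i).2.2]
      exact zero_mem _

theorem HasFiniteBlocks.of_isInternal {ι : Type u} [DecidableEq ι] {A : ι → Submodule K V}
    (hA : DirectSum.IsInternal A) (T : Module.End K V) (hT : ∀ i, Set.MapsTo T (A i) (A i))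
    (h : ∀ i, HasFiniteBlocks (T.restrict (hT i))) : HasFiniteBlocks T := by
  choose J κ b g hfin hg using h
  refine ⟨_, _, hA.collectedBasis b, Sigma.map id g, ?_, ?_⟩
  · rintro ⟨i, k⟩
    refine ((hfin i k).image (Sigma.mk i)).subset ?_
    rintro ⟨i', j⟩ hj
    obtain ⟨rfl, hj⟩ := Sigma.mk.inj_iff.1 (show (⟨i', g i' j⟩ : Σ i, κ i) = ⟨i, k⟩ from hj)
    exact ⟨j, eq_of_heq hj, rfl⟩
  · rintro ⟨i, j⟩
    have := Submodule.mem_map_of_mem (f := (A i).subtype) (hg i j)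
    rw [Submodule.map_span] at this
    rw [hA.collectedBasis_coe]
    refine Submodule.span_mono ?_ this
    rintro _ ⟨_, ⟨j', hj', rfl⟩, rfl⟩
    refine ⟨⟨i, j'⟩, ?_, rfl⟩
    have hj' : g i j' = g i j := hj'
    simp [Sigma.map, hj']

theorem ker_aeval_prod_X_sub_C_pow_le (T : Module.End K V) (f : K → ℕ) (s : Finset K) :
    LinearMap.ker (Polynomial.aeval T (∏ μ ∈ s, (Polynomial.X - Polynomial.C μ) ^ f μ)) ≤
      ⨆ μ, T.genEigenspace μ (f μ) := by
  classical
  induction s using Finset.induction_on with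
  | empty => simp [Module.End.one_eq_id]
  | insert μ s hμ ih =>
    have hcop : IsCoprime ((Polynomial.X - Polynomial.C μ) ^ f μ) (∏ ν ∈ s, (Polynomial.X - Polynomial.C ν) ^ f ν) :=
      IsCoprime.prod_right fun ν hν => IsCoprime.pow <|
        Polynomial.isCoprime_X_sub_C_of_isUnit_sub (sub_ne_zero.2 (ne_of_mem_of_not_mem hν hμ).symm).isUnit
    rw [Finset.prod_insert hμ, ← Polynomial.sup_ker_aeval_eq_ker_aeval_mul_of_coprime T hcop]
    refine sup_le ?_ ih
    refine le_trans (le_of_eq ?_) (le_iSup _ μ)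
    rw [Module.End.genEigenspace_nat]
    simp [Algebra.algebraMap_eq_smul_one]

/-- If every vector is killed by a finite product of factors `T - e k`, where no value of `e` is
taken more than twice, then the space has a basis splitting into finite invariant blocks. -/
theorem hasFiniteBlocks_of_prod_apply_eq_zero (T : Module.End K V) (e : ℕ → K)
    (he : ∀ (s : Finset ℕ) (μ : K), (∀ k ∈ s, e k = μ) → s.card ≤ 2)
    (hT : ∀ v, ∃ n, Polynomial.aeval T (∏ k ∈ Finset.range n, (Polynomial.X - Polynomial.C (e k))) v = 0) :
    HasFiniteBlocks T := by
  classical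
  have htop : ⨆ μ, T.genEigenspace μ 2 = ⊤ := by
    refine eq_top_iff.2 fun v _ => ?_
    obtain ⟨n, hn⟩ := hT v
    let f (μ : K) : ℕ := ({k ∈ Finset.range n | e k = μ} : Finset ℕ).card
    have hf : ∏ k ∈ Finset.range n, (Polynomial.X - Polynomial.C (e k)) =
        ∏ μ ∈ (Finset.range n).image e, (Polynomial.X - Polynomial.C μ) ^ f μ := by
      rw [← Finset.prod_fiberwise_of_maps_to (g := e) fun k => Finset.mem_image_of_mem e]
      refine Finset.prod_congr rfl fun μ _ => ?_
      rw [Finset.prod_congr rfl fun k hk => by rw [(Finset.mem_filter.1 hk).2],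
        Finset.prod_const]
    rw [hf] at hn
    refine iSup_mono (fun μ => (T.genEigenspace μ).monotone ?_)
      (ker_aeval_prod_X_sub_C_pow_le T f _ hn)
    exact_mod_cast he _ μ fun k hk => (Finset.mem_filter.1 hk).2
  have hint : DirectSum.IsInternal fun μ => T.genEigenspace μ 2 :=
    DirectSum.isInternal_submodule_of_iSupIndep_of_iSup_eq_top (T.independent_genEigenspace 2) htop
  have hmaps (μ : K) := Module.End.mapsTo_genEigenspace_of_comm (Commute.refl T) μ 2
  refine .of_isInternal hint T hmaps fun μ => ?_
  let N : Module.End K (T.genEigenspace μ 2) := T.restrict (hmaps μ) - μ • 1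
  have hN : N * N = 0 := by
    ext ⟨v, hv⟩
    have hv' := (Module.End.mem_genEigenspace_nat (k := 2)).1 (by exact_mod_cast hv)
    rw [LinearMap.mem_ker, pow_two] at hv'
    exact hv'
  simpa [N] using (hasFiniteBlocks_of_mul_self_eq_zero N hN).add_smul_one μ

end LinearAlgebra

section Omega

/-- The eigenvalues of `Ω` on the free `ℂ[x+y]`-module `ℂ[x,y]`. -/
noncomputable def omegaEigenvalue (α₁ α₂ : ℂ) (n : ℕ) : ℂ :=
  α₁ * α₂ - n * (2 * α₁ + 2 * α₂ + 1 - n) / 2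

theorem card_le_two_of_omegaEigenvalue_eq (α₁ α₂ : ℂ) (s : Finset ℕ) (μ : ℂ)
    (hs : ∀ k ∈ s, omegaEigenvalue α₁ α₂ k = μ) : s.card ≤ 2 := by
  by_contra! h
  obtain ⟨i, j, k, hi, hj, hk, hij, hik, hjk⟩ := Finset.two_lt_card_iff.1 h
  have key {m n : ℕ} (hm : m ∈ s) (hn : n ∈ s) (hmn : m ≠ n) :
      (m : ℂ) + n = 2 * α₁ + 2 * α₂ + 1 := by
    have h := (hs m hm).trans (hs n hn).symm
    unfold omegaEigenvalue at h
    have hmn' : (m : ℂ) - n ≠ 0 := sub_ne_zero.2 (by exact_mod_cast hmn)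
    refine mul_left_cancel₀ hmn' ?_
    linear_combination 2 * h
  have : (j : ℂ) = k := by linear_combination key hi hj hij - key hi hk hik
  exact hjk (by exact_mod_cast this)

/-- The falling factorials `(x + α₁)(x + α₁ - 1) ⋯ (x + α₁ - n + 1)`, a basis of the free
`ℂ[x+y]`-module `ℂ[x,y]` with respect to which `Ω` is triangular. -/
noncomputable def fallingBasis (α₁ : ℂ) (n : ℕ) : MvPolynomial (Fin 2) ℂ :=
  ∏ i ∈ Finset.range n, (X 0 + C (α₁ - i))

theorem fallingBasis_succ (α₁ : ℂ) (n : ℕ) :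
    fallingBasis α₁ (n + 1) = fallingBasis α₁ n * (X 0 + C (α₁ - n)) :=
  Finset.prod_range_succ _ _

theorem shift_one_fallingBasis_succ (α₁ b : ℂ) (n : ℕ) :
    shift 1 b (fallingBasis α₁ (n + 1)) = (X 0 + C (α₁ + 1)) * fallingBasis α₁ n := by
  rw [fallingBasis, fallingBasis, Finset.prod_range_succ', map_mul, map_prod, mul_comm]
  congr 1
  · simp [shift]
    ring
  · refine Finset.prod_congr rfl fun i _ => ?_
    simp [shift]
    ring

theorem mul_shift_neg_one_fallingBasis (α₁ b : ℂ) (n : ℕ) :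
    (X 0 + C α₁) * shift (-1) b (fallingBasis α₁ n) =
      (X 0 + C (α₁ - n)) * fallingBasis α₁ n := by
  induction n with
  | zero => simp [fallingBasis]
  | succ n ih =>
    rw [fallingBasis_succ, map_mul, ← mul_assoc, ih]
    simp [shift]
    ring

theorem Omega_apply (α₁ α₂ : ℂ) (p : MvPolynomial (Fin 2) ℂ) :
    Omega α₁ α₂ p = -C (1 / 2) * ((X 0 - C α₁) * (X 1 + C α₂) * shift 1 (-1) p)
      + X 0 * X 1 * p - C (1 / 2) * ((X 0 + C α₁) * (X 1 - C α₂) * shift (-1) 1 p) := by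
  simp only [Omega, LinearMap.add_apply, LinearMap.smul_apply, LinearMap.comp_apply,
    LinearMap.mulLeft_apply, AlgHom.toLinearMap_apply, smul_eq_C_mul, C_neg]
  ring

theorem Omega_commute_mulLeft (α₁ α₂ : ℂ) :
    Commute (Omega α₁ α₂) (LinearMap.mulLeft ℂ (X 0 + X 1)) := by
  refine LinearMap.ext fun p => ?_
  have h₁ : shift 1 (-1) (X 0 + X 1) = X 0 + X 1 := by simp [shift]; ring
  have h₂ : shift (-1) 1 (X 0 + X 1) = X 0 + X 1 := by simp [shift]; ring
  simp only [Module.End.mul_apply, LinearMap.mulLeft_apply, Omega_apply, map_mul, h₁, h₂]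
  ring

theorem Omega_fallingBasis_zero (α₁ α₂ : ℂ) :
    Omega α₁ α₂ (fallingBasis α₁ 0) = omegaEigenvalue α₁ α₂ 0 • fallingBasis α₁ 0 := by
  have h : (C (1 / 2) : MvPolynomial (Fin 2) ℂ) * 2 = 1 := by
    rw [show (2 : MvPolynomial (Fin 2) ℂ) = C 2 from rfl, ← C_mul]
    norm_num
  simp only [Omega_apply, fallingBasis, omegaEigenvalue, Finset.range_zero, Finset.prod_empty,
    map_one, smul_eq_C_mul]
  simp only [Nat.cast_zero, zero_mul, zero_div, sub_zero, C_mul]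
  linear_combination (C α₁ * C α₂ - X 0 * X 1) * h

theorem Omega_fallingBasis_succ (α₁ α₂ : ℂ) (n : ℕ) :
    ∃ a b : ℂ, Omega α₁ α₂ (fallingBasis α₁ (n + 1)) =
      omegaEigenvalue α₁ α₂ (n + 1) • fallingBasis α₁ (n + 1)
        + (C a * (X 0 + X 1) + C b) * fallingBasis α₁ n := by
  refine ⟨-(n + 1) * (n - 2 * α₁) / 2, -(n + 1) * (n * (2 * α₁ + 2 * α₂ - n)
    - 2 * α₁ * (α₁ + α₂) + (α₁ - α₂) * n) / 2, ?_⟩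
  rw [Omega_apply, shift_one_fallingBasis_succ, mul_right_comm (X 0 + C α₁),
    mul_shift_neg_one_fallingBasis, fallingBasis_succ]
  refine MvPolynomial.funext fun v => ?_
  simp [omegaEigenvalue]
  ring

theorem exists_prod_Omega_sub_apply_eq_zero (α₁ α₂ : ℂ) (p : MvPolynomial (Fin 2) ℂ) :
    ∃ n, Polynomial.aeval (Omega α₁ α₂) (∏ k ∈ Finset.range n,
      (Polynomial.X - Polynomial.C (omegaEigenvalue α₁ α₂ k))) p = 0 := by
  let P (n : ℕ) : Module.End ℂ (MvPolynomial (Fin 2) ℂ) :=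
    Polynomial.aeval (Omega α₁ α₂) (∏ k ∈ Finset.range n,
      (Polynomial.X - Polynomial.C (omegaEigenvalue α₁ α₂ k)))
  have hP (n : ℕ) (q) : P (n + 1) q =
      P n (Omega α₁ α₂ q - omegaEigenvalue α₁ α₂ n • q) := by
    simp only [P, Finset.prod_range_succ, map_mul, Module.End.mul_apply]
    simp [Algebra.algebraMap_eq_smul_one]
  have hP' (n : ℕ) (q) : P (n + 1) q =
      Omega α₁ α₂ (P n q) - omegaEigenvalue α₁ α₂ n • P n q := by
    simp only [P, Finset.prod_range_succ, mul_comm _ (Polynomial.X - _), map_mul,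
      Module.End.mul_apply]
    simp [Algebra.algebraMap_eq_smul_one]
  have hPs (n : ℕ) (q) : P n ((X 0 + X 1) * q) = (X 0 + X 1) * P n q := by
    induction n with
    | zero => simp [P]
    | succ n ih =>
      have h := LinearMap.congr_fun (Omega_commute_mulLeft α₁ α₂) (P n q)
      simp only [Module.End.mul_apply, LinearMap.mulLeft_apply] at h
      rw [hP', hP', ih, h, mul_sub, mul_smul_comm]
  have hmono : Monotone fun n => LinearMap.ker (P n) :=
    monotone_nat_of_le_succ fun n q hq => by
      rw [LinearMap.mem_ker] at hq ⊢
      simp [hP', hq]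
  let M : Submodule ℂ (MvPolynomial (Fin 2) ℂ) := ⨆ n, LinearMap.ker (P n)
  have hM (q) : q ∈ M ↔ ∃ n, P n q = 0 :=
    Submodule.mem_iSup_of_directed _ hmono.directed_le
  have hMs {q} (hq : q ∈ M) : (X 0 + X 1) * q ∈ M := by
    obtain ⟨n, hn⟩ := (hM q).1 hq
    exact (hM _).2 ⟨n, by rw [hPs, hn, mul_zero]⟩
  have hbasis (n : ℕ) : P (n + 1) (fallingBasis α₁ n) = 0 := by
    induction n with
    | zero => rw [hP, Omega_fallingBasis_zero, sub_self, map_zero]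
    | succ n ih =>
      obtain ⟨a, b, h⟩ := Omega_fallingBasis_succ α₁ α₂ n
      rw [hP, h, add_sub_cancel_left, add_mul, mul_assoc, ← smul_eq_C_mul, ← smul_eq_C_mul,
        map_add, map_smul, map_smul, hPs, ih, mul_zero, smul_zero, smul_zero, add_zero]
  have hmem (q : MvPolynomial (Fin 2) ℂ) : ∀ n, q * fallingBasis α₁ n ∈ M := by
    induction q using MvPolynomial.induction_on with
    | C a =>
      intro n
      rw [← smul_eq_C_mul]
      exact M.smul_mem a ((hM _).2 ⟨n + 1, hbasis n⟩)
    | add q r hq hr =>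
      intro n
      rw [add_mul]
      exact add_mem (hq n) (hr n)
    | mul_X q i hq =>
      have h0 (n : ℕ) : q * X 0 * fallingBasis α₁ n ∈ M := by
        convert M.sub_mem (hq (n + 1)) (M.smul_mem (α₁ - n) (hq n)) using 1
        rw [fallingBasis_succ, smul_eq_C_mul]
        ring
      intro n
      fin_cases i
      · exact h0 n
      · convert M.sub_mem (hMs (hq n)) (h0 n) using 1
        simp only [Fin.mk_one]
        ring
  simpa [fallingBasis] using (hM _).1 (hmem p 0)

end Omega

/-- `ℂ[x,y]` decomposes into a direct sum of finite-dimensional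
`Ω`-invariant subspaces (Proposition 4.3(a)). -/
theorem Omega_locally_finite (α₁ α₂ : ℂ) :
    ∃ W : ℕ → Submodule ℂ (MvPolynomial (Fin 2) ℂ),
      (∀ n, FiniteDimensional ℂ (W n)) ∧
      (∀ n, ∀ p ∈ W n, Omega α₁ α₂ p ∈ W n) ∧
      DirectSum.IsInternal W := by
  obtain ⟨ι, κ, b, g, hfin, hT⟩ := hasFiniteBlocks_of_prod_apply_eq_zero (Omega α₁ α₂)
    (omegaEigenvalue α₁ α₂) (fun s μ hs => card_le_two_of_omegaEigenvalue_eq α₁ α₂ s μ hs)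
    (exists_prod_Omega_sub_apply_eq_zero α₁ α₂)
  have : Countable ι := (b.indexEquiv (basisMonomials (Fin 2) ℂ)).injective.countable
  have : Countable (Set.range g) := (Set.countable_range g).to_subtype
  obtain ⟨e, he⟩ := exists_injective_nat (Set.range g)
  refine ⟨fun n => Submodule.span ℂ (b '' ((fun i => e ⟨g i, i, rfl⟩) ⁻¹' {n})), fun n => ?_,
    fun n p hp => ?_, b.isInternal_span_image_preimage _⟩
  · refine FiniteDimensional.span_of_finite ℂ (Set.Finite.image _ ?_)
    by_cases hn : ∃ i, e ⟨g i, i, rfl⟩ = n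
    · obtain ⟨i, rfl⟩ := hn
      refine (hfin (g i)).subset fun j hj => ?_
      simpa using congrArg Subtype.val (he hj)
    · convert Set.finite_empty
      ext j
      simpa using fun h => hn ⟨j, h⟩
  · induction hp using Submodule.span_induction with
    | mem x hx =>
      obtain ⟨i, rfl, rfl⟩ := hx
      refine Submodule.span_mono (Set.image_mono fun j hj => ?_) (hT i)
      have hj : g j = g i := hj
      simp [hj]
    | zero => simp
    | add x y _ _ hx hy => simpa using add_mem hx hy
    | smul c x _ hx => simpa using Submodule.smul_mem _ c hx
end

section
/- For all α₁, α₂ ∈ ℂ, a complex number μ is an eigenvalue of Ω on ℂ[x,y] (i.e. there exists a nonzero p ∈ ℂ[x,y] with Ω p = μ·p) if and only if μ = ω_n := n²/2 − n(α₁ + α₂ + ½) + α₁α₂ for some n ∈ ℕ. (Proposition 4.3(b).) -/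
open MvPolynomial

namespace OmegaEigenvalues

/-- The coordinates `(x, s)` with `s = x + y`, in which `Ω` is linear over `ℂ[s]`: the map sends
`p(x, y)` to `p(x, s - x)`, as a polynomial in `x` over `ℂ[s]`. -/
noncomputable def toSum : MvPolynomial (Fin 2) ℂ →ₐ[ℂ] Polynomial (Polynomial ℂ) :=
  aeval ![Polynomial.X, Polynomial.C Polynomial.X - Polynomial.X]

/-- The inverse of `toSum`: substitute `s = x + y`. -/
noncomputable def ofSum : Polynomial (Polynomial ℂ) →+* MvPolynomial (Fin 2) ℂ :=
  Polynomial.eval₂RingHom (Polynomial.aeval (X 0 + X 1 : MvPolynomial (Fin 2) ℂ)).toRingHom (X 0)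

lemma ofSum_toSum (p : MvPolynomial (Fin 2) ℂ) : ofSum (toSum p) = p := by
  have h : ofSum.comp toSum.toRingHom = RingHom.id _ := by
    ext i : 2
    · simp [ofSum, toSum, Polynomial.algebraMap_apply, MvPolynomial.algebraMap_eq]
    · fin_cases i <;> simp [ofSum, toSum]
  exact RingHom.congr_fun h p

lemma toSum_ofSum (q : Polynomial (Polynomial ℂ)) : toSum (ofSum q) = q := by
  have h : toSum.toRingHom.comp ofSum = RingHom.id _ := by
    refine Polynomial.ringHom_ext' (Polynomial.ringHom_ext (fun a => ?_) ?_) ?_ <;>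
      simp [ofSum, toSum, Polynomial.algebraMap_apply]
  exact RingHom.congr_fun h q

lemma toSum_shift (a : ℂ) (p : MvPolynomial (Fin 2) ℂ) :
    toSum (shift a (-a) p) = Polynomial.taylor (Polynomial.C a) (toSum p) := by
  have h : toSum.comp (shift a (-a)) =
      ((Polynomial.taylorAlgHom (Polynomial.C a)).restrictScalars ℂ).comp toSum := by
    ext i : 1
    fin_cases i <;> simp [shift, toSum, Polynomial.algebraMap_apply]
    abel
  exact AlgHom.congr_fun h p

section Difference

variable {R : Type*} [CommRing R]

lemma coeff_taylor_one_sub {q : Polynomial R} {m : ℕ} (hq : q.natDegree ≤ m + 1) :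
    (Polynomial.taylor 1 q - q).coeff m = (m + 1) * q.coeff (m + 1) := by
  refine Polynomial.induction_with_natDegree_le
    (fun q : Polynomial R => (Polynomial.taylor 1 q - q).coeff m = (m + 1) * q.coeff (m + 1)) (m + 1)
    (by simp) (fun k r _ hk => ?_) (fun f g _ _ hf hg => ?_) q hq
  · have hc : (Polynomial.taylor 1 (Polynomial.C r * Polynomial.X ^ k)).coeff m =
        r * (k.choose m : R) := by
      simp [Polynomial.taylor_mul, Polynomial.taylor_pow, Polynomial.coeff_X_add_one_pow]
    rw [Polynomial.coeff_sub, hc, Polynomial.coeff_C_mul_X_pow, Polynomial.coeff_C_mul_X_pow]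
    rcases Nat.lt_trichotomy k m with h | rfl | h
    · simp [Nat.choose_eq_zero_of_lt h, h.ne', (show m + 1 ≠ k by omega)]
    · simp
    · obtain rfl : k = m + 1 := by omega
      simp [mul_comm]
  · simp only [map_add, Polynomial.coeff_add, Polynomial.coeff_sub] at *
    linear_combination hf + hg

lemma natDegree_taylor_one_sub_le {q : Polynomial R} {m : ℕ} (hq : q.natDegree ≤ m + 1) :
    (Polynomial.taylor 1 q - q).natDegree ≤ m := by
  refine Polynomial.natDegree_le_iff_coeff_eq_zero.2 fun k hk => ?_
  rw [coeff_taylor_one_sub (by omega), Polynomial.coeff_eq_zero_of_natDegree_lt (by omega),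
    mul_zero]

lemma coeff_taylor_one_sub_eq_zero {q : Polynomial R} {m : ℕ} (hq : q.natDegree ≤ m) :
    (Polynomial.taylor 1 q - q).coeff m = 0 := by
  rw [coeff_taylor_one_sub (by omega), Polynomial.coeff_eq_zero_of_natDegree_lt (by omega),
    mul_zero]

lemma coeff_X_mul_taylor_one_sub {q : Polynomial R} {m : ℕ} (hq : q.natDegree ≤ m) :
    (Polynomial.X * (Polynomial.taylor 1 q - q)).coeff m = m * q.coeff m := by
  cases m with
  | zero => simp
  | succ m => rw [Polynomial.coeff_X_mul, coeff_taylor_one_sub hq, Nat.cast_succ]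

lemma coeff_X_mul_X_mul_taylor_one_sub_sq {q : Polynomial R} {m : ℕ} (hq : q.natDegree ≤ m) :
    (Polynomial.X * (Polynomial.X * (Polynomial.taylor 1 (Polynomial.taylor 1 q - q) -
      (Polynomial.taylor 1 q - q)))).coeff m = m * (m - 1) * q.coeff m := by
  cases m with
  | zero => simp
  | succ m =>
    rw [Polynomial.coeff_X_mul, coeff_X_mul_taylor_one_sub (natDegree_taylor_one_sub_le hq),
      coeff_taylor_one_sub hq]
    push_cast
    ring

lemma coeff_taylor_of_natDegree_le (r : R) {q : Polynomial R} {m : ℕ} (hq : q.natDegree ≤ m) :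
    (Polynomial.taylor r q).coeff m = q.coeff m := by
  rcases hq.lt_or_eq with h | rfl
  · rw [Polynomial.coeff_eq_zero_of_natDegree_lt h,
      Polynomial.coeff_eq_zero_of_natDegree_lt (by rwa [Polynomial.natDegree_taylor])]
  · exact Polynomial.coeff_taylor_natDegree r q

end Difference

/-- The operator `Ω` in the coordinates `(x, s)`. -/
noncomputable def casimir (α₁ α₂ : ℂ) :
    Polynomial (Polynomial ℂ) →ₗ[Polynomial ℂ] Polynomial (Polynomial ℂ) :=
  let x : Polynomial (Polynomial ℂ) := Polynomial.X
  let y : Polynomial (Polynomial ℂ) := Polynomial.C Polynomial.X - Polynomial.X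
  let c (a : ℂ) : Polynomial (Polynomial ℂ) := Polynomial.C (Polynomial.C a)
  LinearMap.mulLeft _ (c (-(1/2)) * ((x - c α₁) * (y + c α₂))) ∘ₗ Polynomial.taylor 1
    + LinearMap.mulLeft _ (x * y)
    + LinearMap.mulLeft _ (c (-(1/2)) * ((x + c α₁) * (y - c α₂))) ∘ₗ Polynomial.taylor (-1)

lemma toSum_C (a : ℂ) : toSum (C a) = Polynomial.C (Polynomial.C a) := by
  simp [toSum, Polynomial.algebraMap_apply]

lemma toSum_smul (a : ℂ) (p : MvPolynomial (Fin 2) ℂ) :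
    toSum (a • p) = Polynomial.C (Polynomial.C a) * toSum p := by
  rw [MvPolynomial.smul_eq_C_mul, map_mul, toSum_C]

lemma toSum_Omega (α₁ α₂ : ℂ) (p : MvPolynomial (Fin 2) ℂ) :
    toSum (Omega α₁ α₂ p) = casimir α₁ α₂ (toSum p) := by
  have h₁ := toSum_shift 1 p
  have h₂ := toSum_shift (-1) p
  have h₀ : toSum (X 0) = Polynomial.X := by simp [toSum]
  have h₃ : toSum (X 1) = Polynomial.C Polynomial.X - Polynomial.X := by simp [toSum]
  rw [neg_neg] at h₂
  simp only [Omega, casimir, LinearMap.add_apply, LinearMap.smul_apply, LinearMap.comp_apply,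
    LinearMap.mulLeft_apply, AlgHom.toLinearMap_apply, map_add, toSum_smul, map_mul, map_sub,
    h₁, h₂, h₀, h₃, toSum_C, map_one, map_neg, mul_assoc]

/-- The eigenvalue `ω_n`. -/
noncomputable def eigenvalue (α₁ α₂ : ℂ) (n : ℕ) : ℂ :=
  (n : ℂ) ^ 2 / 2 - (n : ℂ) * (α₁ + α₂ + 1/2) + α₁ * α₂

/-- `casimir` in terms of forward differences: second difference of `q(x - 1)`, first differences
of `q(x)` and `q(x - 1)`. -/
lemma casimir_eq (α₁ α₂ : ℂ) (q : Polynomial (Polynomial ℂ)) :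
    let r := Polynomial.taylor (-1) q
    let d := Polynomial.taylor 1 r - r
    let w := Polynomial.taylor 1 d - d
    let u := (Polynomial.taylor 1 q - q) + d
    casimir α₁ α₂ q = Polynomial.C (Polynomial.C (α₁ * α₂)) * q
      + Polynomial.C (Polynomial.C (1/2)) * (Polynomial.X * (Polynomial.X * w))
      - Polynomial.C (Polynomial.C (1/2) * Polynomial.X) * (Polynomial.X * w)
      + Polynomial.C (Polynomial.C (1/2 * (α₁ * α₂))) * w
      - Polynomial.C (Polynomial.C (1/2 * (α₁ + α₂))) * (Polynomial.X * u)
      + Polynomial.C (Polynomial.C (1/2 * α₁) * Polynomial.X) * u := by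
  intro r d w u
  have hr : Polynomial.taylor 1 r = q := by simp [r, Polynomial.taylor_taylor]
  have hh : (2 : Polynomial (Polynomial ℂ)) * Polynomial.C (Polynomial.C (1/2)) = 1 := by
    rw [← map_ofNat (Polynomial.C.comp Polynomial.C) 2, RingHom.comp_apply, ← map_mul, ← map_mul]
    norm_num
  simp only [casimir, LinearMap.add_apply, LinearMap.comp_apply, LinearMap.mulLeft_apply, u, w, d,
    map_sub, hr, map_mul, map_add, map_neg]
  set h : Polynomial (Polynomial ℂ) := Polynomial.C (Polynomial.C (1/2))
  set a := Polynomial.C (Polynomial.C α₁)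
  set b := Polynomial.C (Polynomial.C α₂)
  set s : Polynomial (Polynomial ℂ) := Polynomial.C Polynomial.X
  set x : Polynomial (Polynomial ℂ) := Polynomial.X
  linear_combination (x * (s - x) * q - a * b * q) * (-hh)

lemma coeff_casimir (α₁ α₂ : ℂ) {q : Polynomial (Polynomial ℂ)} {m : ℕ} (hq : q.natDegree ≤ m) :
    (casimir α₁ α₂ q).coeff m = Polynomial.C (eigenvalue α₁ α₂ m) * q.coeff m := by
  have hr : (Polynomial.taylor (-1) q).natDegree ≤ m := by rwa [Polynomial.natDegree_taylor]
  have hcr := coeff_taylor_of_natDegree_le (-1) hq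
  rw [casimir_eq]
  generalize Polynomial.taylor (-1) q = r at hr hcr ⊢
  have hd : (Polynomial.taylor 1 r - r).natDegree ≤ m :=
    natDegree_taylor_one_sub_le (hr.trans m.le_succ)
  simp only [Polynomial.coeff_add, Polynomial.coeff_sub, Polynomial.coeff_C_mul,
    coeff_X_mul_X_mul_taylor_one_sub_sq hr, coeff_X_mul_taylor_one_sub hd,
    coeff_taylor_one_sub_eq_zero hd, mul_add, coeff_X_mul_taylor_one_sub hr,
    coeff_X_mul_taylor_one_sub hq, coeff_taylor_one_sub_eq_zero hr,
    coeff_taylor_one_sub_eq_zero hq, hcr]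
  have hm : (m : Polynomial ℂ) = Polynomial.C (m : ℂ) := by simp
  have hω : Polynomial.C (eigenvalue α₁ α₂ m) = Polynomial.C (α₁ * α₂)
      + Polynomial.C (1/2) * (Polynomial.C (m : ℂ) * (Polynomial.C (m : ℂ) - 1))
      - 2 * (Polynomial.C (1/2 * α₁ + 1/2 * α₂) * Polynomial.C (m : ℂ)) := by
    rw [← map_one Polynomial.C, ← map_ofNat Polynomial.C 2]
    simp only [← map_mul, ← map_add, ← map_sub, eigenvalue]
    congr 1
    ring
  rw [hω, hm]
  ring

lemma exists_casimir_eq (α₁ α₂ : ℂ) (n : ℕ) : ∃ q : Polynomial (Polynomial ℂ), q ≠ 0 ∧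
    casimir α₁ α₂ q = Polynomial.C (Polynomial.C (eigenvalue α₁ α₂ n)) * q := by
  let S : Polynomial (Polynomial ℂ) →ₗ[Polynomial ℂ] Polynomial (Polynomial ℂ) :=
    casimir α₁ α₂ - Polynomial.C (eigenvalue α₁ α₂ n) • LinearMap.id
  have hS (q : Polynomial.degreeLT (Polynomial ℂ) (n + 1)) :
      S q ∈ Polynomial.degreeLT (Polynomial ℂ) n := by
    have hq : (q : Polynomial (Polynomial ℂ)).natDegree ≤ n :=
      Polynomial.natDegree_le_iff_coeff_eq_zero.2 fun k hk =>
        Polynomial.coeff_eq_zero_of_degree_lt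
          ((Polynomial.mem_degreeLT.1 q.2).trans_le (by exact_mod_cast hk))
    rw [Polynomial.mem_degreeLT, Polynomial.degree_lt_iff_coeff_zero]
    intro m hm
    have hc := coeff_casimir α₁ α₂ (hq.trans hm)
    rcases hm.eq_or_lt with rfl | hm
    · simp [S, hc]
    · simp [S, hc, Polynomial.coeff_eq_zero_of_natDegree_lt (hq.trans_lt hm)]
  let S' := (S.comp (Polynomial.degreeLT (Polynomial ℂ) (n + 1)).subtype).codRestrict _ hS
  have hni : ¬ Function.Injective S' := fun hi => by
    let e := Polynomial.degreeLTEquiv (Polynomial ℂ) n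
    let e' := (Polynomial.degreeLTEquiv (Polynomial ℂ) (n + 1)).symm
    have := le_of_fin_injective (Polynomial ℂ) (e.toLinearMap ∘ₗ S' ∘ₗ e'.toLinearMap)
      (e.injective.comp (hi.comp e'.injective))
    omega
  rw [injective_iff_map_eq_zero] at hni
  push Not at hni
  obtain ⟨q, hq, hq0⟩ := hni
  refine ⟨q, fun h => hq0 (Subtype.ext h), ?_⟩
  have h : S q = 0 := congrArg Subtype.val hq
  rw [← Polynomial.smul_eq_C_mul]
  exact sub_eq_zero.1 h

end OmegaEigenvalues

/-- A complex number `μ` is an eigenvalue of `Ω` on `ℂ[x,y]` if and only if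
`μ = ω_n = n²/2 − n(α₁ + α₂ + ½) + α₁α₂` for some `n ∈ ℕ` (Proposition 4.3(b)). -/
theorem Omega_eigenvalues (α₁ α₂ : ℂ) (μ : ℂ) :
    (∃ p : MvPolynomial (Fin 2) ℂ, p ≠ 0 ∧ Omega α₁ α₂ p = μ • p) ↔
    ∃ n : ℕ, μ = (n : ℂ) ^ 2 / 2 - (n : ℂ) * (α₁ + α₂ + 1/2) + α₁ * α₂ := by
  constructor
  · rintro ⟨p, hp, h⟩
    have hq : OmegaEigenvalues.toSum p ≠ 0 := fun h0 => hp <| by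
      rw [← OmegaEigenvalues.ofSum_toSum p, h0, map_zero]
    refine ⟨(OmegaEigenvalues.toSum p).natDegree, ?_⟩
    have hc := OmegaEigenvalues.coeff_casimir α₁ α₂ (le_refl (OmegaEigenvalues.toSum p).natDegree)
    rw [← OmegaEigenvalues.toSum_Omega, h, OmegaEigenvalues.toSum_smul, Polynomial.coeff_C_mul]
      at hc
    exact Polynomial.C_injective
      (mul_right_cancel₀ (mt Polynomial.leadingCoeff_eq_zero.1 hq) hc)
  · rintro ⟨n, rfl⟩
    obtain ⟨q, hq, h⟩ := OmegaEigenvalues.exists_casimir_eq α₁ α₂ n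
    refine ⟨OmegaEigenvalues.ofSum q, fun h0 => hq ?_, ?_⟩
    · rw [← OmegaEigenvalues.toSum_ofSum q, h0, map_zero]
    · apply Function.LeftInverse.injective OmegaEigenvalues.ofSum_toSum
      rw [OmegaEigenvalues.toSum_Omega, OmegaEigenvalues.toSum_smul,
        OmegaEigenvalues.toSum_ofSum, h, OmegaEigenvalues.eigenvalue]
end

section
/- For all α₁, α₂ ∈ ℂ, the operator F = f_x + f_y is injective on ℂ[x,y]. (This is the injectivity of the action of f ∈ sl₂(ℂ) on the tensor product of two Verma modules, used in the proof of Proposition 4.3, where F maps V_{n−1} injectively into V_n.) -/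
open MvPolynomial

/-- `(f_x p)(x,y) = −½((α₁−x)·p(x+1,y) − 2x·p(x,y) − (α₁+x)·p(x−1,y))`. -/
noncomputable def fX (α₁ : ℂ) : Module.End ℂ (MvPolynomial (Fin 2) ℂ) :=
  (-(1/2 : ℂ)) • (LinearMap.mulLeft ℂ (C α₁ - X 0) ∘ₗ (shift 1 0).toLinearMap
    - LinearMap.mulLeft ℂ (C 2 * X 0)
    - LinearMap.mulLeft ℂ (C α₁ + X 0) ∘ₗ (shift (-1) 0).toLinearMap)

/-- `(f_y p)(x,y) = −½((α₂−y)·p(x,y+1) − 2y·p(x,y) − (α₂+y)·p(x,y−1))`. -/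
noncomputable def fY (α₂ : ℂ) : Module.End ℂ (MvPolynomial (Fin 2) ℂ) :=
  (-(1/2 : ℂ)) • (LinearMap.mulLeft ℂ (C α₂ - X 1) ∘ₗ (shift 0 1).toLinearMap
    - LinearMap.mulLeft ℂ (C 2 * X 1)
    - LinearMap.mulLeft ℂ (C α₂ + X 1) ∘ₗ (shift 0 (-1)).toLinearMap)

/-- Substituting `p(x+a, y+b)` does not raise the degree of a monomial, and changes it only in
lower degree. -/
theorem totalDegree_shift_monomial (a b : ℂ) (k : Fin 2) (s : Fin 2 →₀ ℕ) :
    (shift a b (monomial s 1)).totalDegree ≤ s.degree ∧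
      (X k * (shift a b (monomial s 1) - monomial s 1)).totalDegree ≤ s.degree := by
  have add : ∀ s t : Fin 2 →₀ ℕ,
      ((shift a b (monomial s 1)).totalDegree ≤ s.degree ∧
        (X k * (shift a b (monomial s 1) - monomial s 1)).totalDegree ≤ s.degree) →
      ((shift a b (monomial t 1)).totalDegree ≤ t.degree ∧
        (X k * (shift a b (monomial t 1) - monomial t 1)).totalDegree ≤ t.degree) →
      ((shift a b (monomial (s + t) 1)).totalDegree ≤ (s + t).degree ∧
        (X k * (shift a b (monomial (s + t) 1) - monomial (s + t) 1)).totalDegree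
          ≤ (s + t).degree) := by
    rintro s t ⟨hs, hs'⟩ ⟨ht, ht'⟩
    have hmul : (monomial (s + t) 1 : MvPolynomial (Fin 2) ℂ) = monomial s 1 * monomial t 1 := by
      simp [monomial_mul]
    have hdeg : (s + t).degree = s.degree + t.degree := by simp
    have hm : (monomial s (1 : ℂ)).totalDegree ≤ s.degree := by
      rw [totalDegree_monomial _ one_ne_zero]; exact le_of_eq rfl
    rw [hmul, map_mul, hdeg]
    refine ⟨(totalDegree_mul _ _).trans (add_le_add hs ht), ?_⟩
    rw [show X k * (shift a b (monomial s 1) * shift a b (monomial t 1)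
          - monomial s 1 * monomial t 1)
        = X k * (shift a b (monomial s 1) - monomial s 1) * shift a b (monomial t 1)
          + monomial s 1 * (X k * (shift a b (monomial t 1) - monomial t 1)) by ring]
    exact (totalDegree_add _ _).trans (max_le
      ((totalDegree_mul _ _).trans (add_le_add hs' ht))
      ((totalDegree_mul _ _).trans (add_le_add hm ht')))
  have zero : (shift a b (monomial 0 1)).totalDegree ≤ (0 : Fin 2 →₀ ℕ).degree ∧
      (X k * (shift a b (monomial 0 1) - monomial 0 1)).totalDegree
        ≤ (0 : Fin 2 →₀ ℕ).degree := by
    simp [show (monomial 0 1 : MvPolynomial (Fin 2) ℂ) = 1 from rfl]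
  induction s using Finsupp.induction_linear with
  | zero => exact zero
  | add s t hs ht => exact add s t hs ht
  | single i n =>
    induction n with
    | zero => simp
    | succ n ih =>
      rw [Finsupp.single_add]
      refine add _ _ ih ?_
      change (shift a b (X i)).totalDegree ≤ _ ∧ (X k * (shift a b (X i) - X i)).totalDegree ≤ _
      have hX : ∃ c : ℂ, shift a b (X i) = X i + C c := by
        fin_cases i
        · exact ⟨a, by simp [shift]⟩
        · exact ⟨b, by simp [shift]⟩
      obtain ⟨c, hc⟩ := hX
      rw [hc, add_sub_cancel_left, Finsupp.degree_single]
      refine ⟨(totalDegree_add _ _).trans (by simp), (totalDegree_mul _ _).trans (by simp)⟩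

theorem totalDegree_shift_le (a b : ℂ) (p : MvPolynomial (Fin 2) ℂ) :
    (shift a b p).totalDegree ≤ p.totalDegree := by
  conv_lhs => rw [p.as_sum, map_sum]
  refine totalDegree_finsetSum_le fun s hs => ?_
  rw [← mul_one (coeff s p), ← smul_eq_mul, ← smul_monomial, map_smul]
  exact (totalDegree_smul_le _ _).trans
    ((totalDegree_shift_monomial a b 0 s).1.trans (le_totalDegree hs))

theorem totalDegree_X_mul_shift_sub_le (a b : ℂ) (k : Fin 2) (p : MvPolynomial (Fin 2) ℂ) :
    (X k * (shift a b p - p)).totalDegree ≤ p.totalDegree := by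
  have h : X k * (shift a b p - p) = ∑ s ∈ p.support,
      coeff s p • (X k * (shift a b (monomial s 1) - monomial s 1)) := by
    conv_lhs => rw [p.as_sum]
    rw [map_sum, ← Finset.sum_sub_distrib, Finset.mul_sum]
    refine Finset.sum_congr rfl fun s _ => ?_
    rw [← mul_smul_comm, smul_sub, ← map_smul, smul_monomial, smul_eq_mul, mul_one]
  rw [h]
  exact totalDegree_finsetSum_le fun s hs => (totalDegree_smul_le _ _).trans
    ((totalDegree_shift_monomial a b k s).2.trans (le_totalDegree hs))

/-- A difference operator of the shape of `fX` and `fY` is multiplication by `2 X k` up to terms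
that do not raise the degree. -/
theorem totalDegree_lowering_sub_le (α a b c d : ℂ) (k : Fin 2) (p : MvPolynomial (Fin 2) ℂ) :
    ((-(1/2 : ℂ)) • ((C α - X k) * shift a b p - C 2 * X k * p - (C α + X k) * shift c d p)
      - C 2 * (X k * p)).totalDegree ≤ p.totalDegree := by
  have h : (-(1/2 : ℂ)) • ((C α - X k) * shift a b p - C 2 * X k * p
        - (C α + X k) * shift c d p) - C 2 * (X k * p)
      = (-(1/2 : ℂ)) • (α • (shift a b p - shift c d p)
        - (X k * (shift a b p - p) + X k * (shift c d p - p))) := by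
    have h2 : (C 2 : MvPolynomial (Fin 2) ℂ) = 2 := map_ofNat C 2
    have hhalf : (C (-(1/2)) : MvPolynomial (Fin 2) ℂ) * 2 = -1 := by
      rw [← h2, ← C_mul]; norm_num
    simp only [smul_eq_C_mul, h2]
    linear_combination (-2 * X k * p) * hhalf
  rw [h]
  refine (totalDegree_smul_le _ _).trans ((totalDegree_sub _ _).trans (max_le ?_ ?_))
  · exact (totalDegree_smul_le _ _).trans ((totalDegree_sub _ _).trans
      (max_le (totalDegree_shift_le _ _ _) (totalDegree_shift_le _ _ _)))
  · exact (totalDegree_add _ _).trans (max_le (totalDegree_X_mul_shift_sub_le _ _ _ _)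
      (totalDegree_X_mul_shift_sub_le _ _ _ _))

/-- The operator `F = f_x + f_y` is injective on `ℂ[x,y]`. -/
theorem F_injective (α₁ α₂ : ℂ) :
    Function.Injective (fX α₁ + fY α₂) := by
  rw [injective_iff_map_eq_zero]
  intro p hp
  by_contra hp0
  have hx : (fX α₁ p - C 2 * (X 0 * p)).totalDegree ≤ p.totalDegree :=
    totalDegree_lowering_sub_le α₁ 1 0 (-1) 0 0 p
  have hy : (fY α₂ p - C 2 * (X 1 * p)).totalDegree ≤ p.totalDegree :=
    totalDegree_lowering_sub_le α₂ 0 1 0 (-1) 1 p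
  have hsum := (totalDegree_add _ _).trans (max_le hx hy)
  rw [show fX α₁ p - C 2 * (X 0 * p) + (fY α₂ p - C 2 * (X 1 * p))
      = (fX α₁ + fY α₂) p - C 2 * ((X 0 + X 1) * p) by rw [LinearMap.add_apply]; ring,
    hp, zero_sub, totalDegree_neg] at hsum
  have hne : (X 0 + X 1 : MvPolynomial (Fin 2) ℂ) ≠ 0 := fun h => by
    simpa using congrArg (eval ![1, 0]) h
  have hhom : (X 0 + X 1 : MvPolynomial (Fin 2) ℂ).totalDegree = 1 :=
    ((isHomogeneous_X ℂ 0).add (isHomogeneous_X ℂ 1)).totalDegree hne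
  rw [totalDegree_mul_of_isDomain (by simp) (mul_ne_zero hne hp0),
    totalDegree_mul_of_isDomain hne hp0, hhom, totalDegree_C] at hsum
  omega
end

section
/- For all α₁, α₂ ∈ ℂ, the family of polynomials (f_x^i f_y^j (1))_{(i,j) ∈ ℕ×ℕ} (iterates of the commuting operators f_x and f_y applied to the constant polynomial 1) is a ℂ-basis of ℂ[x,y]. (This realizes ℂ[x,y] as the tensor product M_{2α₁} ⊗ M_{2α₂} of two Verma modules over sl₂(ℂ), with V_n = span{f_x^k f_y^{n−k}(1) : 0 ≤ k ≤ n} giving the weight-space decomposition used in the proof of Proposition 4.3.) -/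
open MvPolynomial

/-- The one-variable lowering operator
`p(x) ↦ −½((α−x)·p(x+1) − 2x·p(x) − (α+x)·p(x−1))` on `ℂ[x]`. -/
noncomputable def lowering (α : ℂ) (p : Polynomial ℂ) : Polynomial ℂ :=
  (-(1/2 : ℂ)) • ((Polynomial.C α - Polynomial.X) * Polynomial.taylor 1 p
    - Polynomial.C 2 * Polynomial.X * p
    - (Polynomial.C α + Polynomial.X) * Polynomial.taylor (-1) p)

lemma degree_lowering (α : ℂ) {p : Polynomial ℂ} {n : ℕ} (hp : p.degree = n) :
    (lowering α p).degree = (n + 1 : ℕ) := by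
  have hn : p.natDegree = n := Polynomial.natDegree_eq_of_degree_eq_some hp
  have hlead : p.coeff n ≠ 0 := Polynomial.coeff_ne_zero_of_eq_degree hp
  have hdeg (r : ℂ) : (Polynomial.taylor r p).natDegree = n := by
    rw [Polynomial.natDegree_taylor, hn]
  have htop (r : ℂ) : (Polynomial.taylor r p).coeff n = p.coeff n := by
    have h := Polynomial.coeff_taylor_natDegree (f := p) (r := r)
    rwa [hn, Polynomial.leadingCoeff, hn] at h
  have hzero (r : ℂ) : (Polynomial.taylor r p).coeff (n + 1) = 0 :=
    Polynomial.coeff_eq_zero_of_natDegree_lt (by rw [hdeg]; omega)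
  apply Polynomial.degree_eq_of_le_of_coeff_ne_zero
  · apply Polynomial.degree_le_of_natDegree_le
    refine (Polynomial.natDegree_smul_le _ _).trans ?_
    have hmul (q s : Polynomial ℂ) (hq : q.natDegree ≤ 1) (hs : s.natDegree = n) :
        (q * s).natDegree ≤ n + 1 :=
      Polynomial.natDegree_mul_le.trans (by omega)
    refine Polynomial.natDegree_sub_le_of_le (n := n + 1)
      (Polynomial.natDegree_sub_le_of_le (n := n + 1)
        (hmul _ _ ?_ (hdeg 1)) (hmul _ _ ?_ hn)) (hmul _ _ ?_ (hdeg (-1))) |>.trans (by simp) <;>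
    compute_degree
  · have hcoeff : (lowering α p).coeff (n + 1) = 2 * p.coeff n := by
      simp only [lowering, Polynomial.coeff_smul, Polynomial.coeff_sub, sub_mul, add_mul,
        Polynomial.coeff_add, mul_assoc, Polynomial.coeff_C_mul, Polynomial.coeff_X_mul, hzero,
        htop, smul_eq_mul]
      ring
    rw [hcoeff]
    exact mul_ne_zero two_ne_zero hlead

/-- The iterates of `lowering α` on the constant polynomial `1`. -/
noncomputable def loweringSequence (α : ℂ) : Polynomial.Sequence ℂ where
  elems' i := (lowering α)^[i] 1
  degree_eq' i := by
    induction i with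
    | zero => simp
    | succ i ih =>
      rw [Function.iterate_succ_apply']
      exact degree_lowering α ih

lemma loweringSequence_apply (α : ℂ) (i : ℕ) :
    loweringSequence α i = (lowering α)^[i] 1 := rfl

lemma shift_aeval_X_zero (a b : ℂ) (p : Polynomial ℂ) :
    shift a b (Polynomial.aeval (X 0) p) = Polynomial.aeval (X 0) (Polynomial.taylor a p) := by
  rw [← Polynomial.aeval_algHom_apply, Polynomial.taylor_apply, Polynomial.aeval_comp]
  simp [shift, algebraMap_eq]

lemma shift_aeval_X_one (a b : ℂ) (p : Polynomial ℂ) :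
    shift a b (Polynomial.aeval (X 1) p) = Polynomial.aeval (X 1) (Polynomial.taylor b p) := by
  rw [← Polynomial.aeval_algHom_apply, Polynomial.taylor_apply, Polynomial.aeval_comp]
  simp [shift, algebraMap_eq]

lemma fX_aeval_mul (α : ℂ) (p q : Polynomial ℂ) :
    fX α (Polynomial.aeval (X 0) p * Polynomial.aeval (X 1) q) =
      Polynomial.aeval (X 0) (lowering α p) * Polynomial.aeval (X 1) q := by
  simp only [fX, lowering, LinearMap.smul_apply, LinearMap.sub_apply, LinearMap.comp_apply,
    LinearMap.mulLeft_apply, AlgHom.toLinearMap_apply, map_mul, shift_aeval_X_zero,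
    shift_aeval_X_one, map_smul, map_sub, map_add, Polynomial.aeval_X, Polynomial.aeval_C,
    algebraMap_eq, Polynomial.taylor_zero, smul_mul_assoc]
  congr 1
  ring

lemma fY_aeval (α : ℂ) (q : Polynomial ℂ) :
    fY α (Polynomial.aeval (X 1) q) = Polynomial.aeval (X 1) (lowering α q) := by
  simp only [fY, lowering, LinearMap.smul_apply, LinearMap.sub_apply, LinearMap.comp_apply,
    LinearMap.mulLeft_apply, AlgHom.toLinearMap_apply, map_mul,
    shift_aeval_X_one, map_smul, map_sub, map_add, Polynomial.aeval_X, Polynomial.aeval_C,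
    algebraMap_eq]

lemma fX_pow_fY_pow_one (α₁ α₂ : ℂ) (i j : ℕ) :
    (fX α₁ ^ i) ((fY α₂ ^ j) 1) =
      Polynomial.aeval (X 0) (loweringSequence α₁ i) *
        Polynomial.aeval (X 1) (loweringSequence α₂ j) := by
  simp only [loweringSequence_apply]
  induction i with
  | zero =>
    induction j with
    | zero => simp
    | succ j ih =>
      simp only [pow_zero, Module.End.one_apply, Function.iterate_zero, id, map_one,
        one_mul] at ih ⊢
      rw [pow_succ', Module.End.mul_apply, ih, fY_aeval, Function.iterate_succ_apply']
  | succ i ih =>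
    rw [pow_succ', Module.End.mul_apply, ih, fX_aeval_mul, Function.iterate_succ_apply']

open scoped TensorProduct in
/-- The linear isomorphism `ℂ[x] ⊗ ℂ[y] ≃ ℂ[x,y]`. -/
noncomputable def polynomialTensorEquiv :
    Polynomial ℂ ⊗[ℂ] Polynomial ℂ ≃ₗ[ℂ] MvPolynomial (Fin 2) ℂ :=
  ((Polynomial.basisMonomials ℂ).tensorProduct (Polynomial.basisMonomials ℂ)).equiv
    (MvPolynomial.basisMonomials (Fin 2) ℂ) (finTwoArrowEquiv' ℕ).symm

lemma polynomialTensorEquiv_tmul (p q : Polynomial ℂ) :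
    polynomialTensorEquiv (p ⊗ₜ[ℂ] q) =
      Polynomial.aeval (X 0) p * Polynomial.aeval (X 1) q := by
  have h : polynomialTensorEquiv.toLinearMap = LinearMap.mul' ℂ _ ∘ₗ
      TensorProduct.map (Polynomial.aeval (X 0)).toLinearMap
        (Polynomial.aeval (X 1)).toLinearMap := by
    refine ((Polynomial.basisMonomials ℂ).tensorProduct (Polynomial.basisMonomials ℂ)).ext ?_
    rintro ⟨i, j⟩
    have hb : ((Polynomial.basisMonomials ℂ).tensorProduct (Polynomial.basisMonomials ℂ)).equiv
        (MvPolynomial.basisMonomials (Fin 2) ℂ) (finTwoArrowEquiv' ℕ).symm _ = _ :=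
      Module.Basis.equiv_apply _ (i, j) _ _
    rw [LinearEquiv.coe_coe, polynomialTensorEquiv, hb]
    simp [Module.Basis.tensorProduct_apply, Polynomial.aeval_monomial, monomial_eq,
      Finsupp.prod_fintype, finTwoArrowEquiv']
  exact LinearMap.congr_fun h (p ⊗ₜ[ℂ] q)

/-- The family `(f_x^i f_y^j (1))_{(i,j) ∈ ℕ×ℕ}` is a `ℂ`-basis of `ℂ[x,y]`,
realizing `ℂ[x,y]` as the tensor product `M_{2α₁} ⊗ M_{2α₂}` of two Verma
modules over `sl₂(ℂ)`. -/
theorem iterates_fX_fY_one_basis (α₁ α₂ : ℂ) :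
    LinearIndependent ℂ
      (fun ij : ℕ × ℕ => (fX α₁ ^ ij.1) ((fY α₂ ^ ij.2) (1 : MvPolynomial (Fin 2) ℂ))) ∧
    Submodule.span ℂ
      (Set.range fun ij : ℕ × ℕ =>
        (fX α₁ ^ ij.1) ((fY α₂ ^ ij.2) (1 : MvPolynomial (Fin 2) ℂ))) = ⊤ := by
  have hunit (α : ℂ) (i : ℕ) : IsUnit (loweringSequence α i).leadingCoeff := by
    simp
  let b := (((loweringSequence α₁).basis (hunit α₁)).tensorProduct
    ((loweringSequence α₂).basis (hunit α₂))).map polynomialTensorEquiv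
  have hb : (fun ij : ℕ × ℕ => (fX α₁ ^ ij.1) ((fY α₂ ^ ij.2) (1 : MvPolynomial (Fin 2) ℂ)))
      = b := by
    funext ij
    simp [b, Module.Basis.tensorProduct_apply', polynomialTensorEquiv_tmul, fX_pow_fY_pow_one]
  rw [hb]
  exact ⟨b.linearIndependent, b.span_eq⟩
end

section
/- Let α ∈ ℂ and set ω_n = ½(n² − (2α+3)n + 2α) for n ∈ ℕ (the spectrum of the Casimir operator Ω with α₁ = 1, α₂ = α; note ω₁ = −1). Then the set {ω_n : n ∈ ℕ} contains a non-negative integer if and only if α ∈ ℚ. Consequently, for α ∉ ℚ the operators Ω − j·I are invertible for all integers j ≥ 0. -/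
/-- Let `ω_n = ½(n² − (2α+3)n + 2α)` (the spectrum of the Casimir operator `Ω`
with `α₁ = 1, α₂ = α`). The set `{ω_n : n ∈ ℕ}` contains a non-negative integer
if and only if `α ∈ ℚ`.  (Consequently, for `α ∉ ℚ` the operators `Ω − j·I` are
invertible for all integers `j ≥ 0`.) -/
theorem omega_spectrum_nonneg_integer_iff_rational (α : ℂ) :
    (∃ n : ℕ, ∃ j : ℕ,
        ((n : ℂ) ^ 2 - (2 * α + 3) * (n : ℂ) + 2 * α) / 2 = (j : ℂ)) ↔
    ∃ q : ℚ, α = (q : ℂ) := by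
  constructor
  · rintro ⟨n, j, h⟩
    have hn : (n : ℂ) - 1 ≠ 0 := by
      intro h1
      have hj : ((j + 1 : ℕ) : ℂ) = 0 := by
        push_cast
        linear_combination -h + ((n : ℂ) - 2 - 2 * α) / 2 * h1
      exact absurd (Nat.cast_eq_zero.mp hj) (Nat.succ_ne_zero j)
    refine ⟨((n : ℚ) * (n - 3) / 2 - j) / (n - 1), ?_⟩
    push_cast
    rw [eq_div_iff hn]
    linear_combination -h
  · rintro ⟨q, rfl⟩
    have hd : (1 : ℤ) ≤ q.den := by exact_mod_cast q.pos
    obtain ⟨k, hk⟩ : ∃ k : ℕ, k = q.num.natAbs + 2 := ⟨_, rfl⟩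
    have hp : q.num + 2 ≤ k := by omega
    have hk2 : (2 : ℤ) ≤ k := by omega
    have hdk : (k : ℤ) ≤ q.den * k := by nlinarith
    have hnonneg : 0 ≤ (1 + 2 * (q.den * k : ℤ)) * (q.den * k - 1) - 2 * q.num * k := by
      nlinarith [mul_nonneg (sub_nonneg.mpr hdk) (by linarith : (0 : ℤ) ≤ k)]
    obtain ⟨j, hj⟩ := Int.eq_ofNat_of_zero_le hnonneg
    refine ⟨1 + 2 * (q.den * k), j, ?_⟩
    have hjC := congrArg (Int.cast : ℤ → ℂ) hj
    have hq : (q : ℂ) * q.den = q.num := by exact_mod_cast q.mul_den_eq_num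
    push_cast at hjC ⊢
    linear_combination hjC - 2 * (k : ℂ) * hq
end
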